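/- arXiv:2203.16900 — 6 statements merged into one kernel-verified Lean document; each statement's English description precedes it below -/
import Mathlib

section
/- Let t ≥ 2 be an integer, let G be a finite connected simple graph with no induced P_t, and let r be a vertex of G. Then there exists a Gyárfás decomposition of G with initial vertex r whose height is at most t − 2. -/
/-- The path graph on `t` vertices: `i` and `j` are adjacent iff `|i - j| = 1`. -/
def pathG (t : ℕ) : SimpleGraph (Fin t) :=
  SimpleGraph.fromRel (fun i j => (i : ℕ) + 1 = (j : ℕ))

/-- `G` contains `H` as an induced subgraph. -/
def ContainsInduced {W V : Type*} (H : SimpleGraph W) (G : SimpleGraph V) : Prop :=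
  ∃ f : W → V, Function.Injective f ∧
    ∀ u v : W, u ≠ v → (G.Adj (f u) (f v) ↔ H.Adj u v)

/-- A Gyárfás decomposition of a connected graph `G`: a finite rooted tree
(given by an index type `ι`, a root, and a parent function) whose nodes are
pairwise disjoint nonempty bags partitioning the vertex set.  The bag `b'` is a
descendant of `b` (equivalently, `b` is an ancestor of `b'`) iff some iterate of
the parent function maps `b'` to `b`. -/
structure GyarfasDecomp {V : Type*} (G : SimpleGraph V) where
  /-- index type of the bags -/
  ι : Type
  /-- the tree is finite -/
  fin : Fintype ι
  /-- the bags -/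
  bag : ι → Set V
  /-- the root node -/
  root : ι
  /-- the parent function of the rooted tree -/
  parent : ι → ι
  /-- the level of each node (its distance from the root) -/
  level : ι → ℕ
  /-- the initial vertex -/
  init : V
  parent_root : parent root = root
  /-- every node reaches the root by iterating the parent map (tree-ness) -/
  reach : ∀ b : ι, ∃ n : ℕ, parent^[n] b = root
  level_root : level root = 0
  level_parent : ∀ b : ι, b ≠ root → level b = level (parent b) + 1
  bag_nonempty : ∀ b : ι, (bag b).Nonempty
  bag_disjoint : ∀ b b' : ι, b ≠ b' → Disjoint (bag b) (bag b')
  bag_cover : ∀ v : V, ∃ b : ι, v ∈ bag b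
  root_bag : bag root = {init}
  /-- endpoints of an edge lie in bags comparable in the ancestor order -/
  adj_anc : ∀ (u u' : V) (b b' : ι), u ∈ bag b → u' ∈ bag b' → G.Adj u u' →
    (∃ n : ℕ, parent^[n] b' = b) ∨ (∃ n : ℕ, parent^[n] b = b')
  /-- the union of a bag and all its descendants induces a connected subgraph -/
  conn : ∀ b : ι,
    (G.induce {v : V | ∃ b' : ι, (∃ n : ℕ, parent^[n] b' = b) ∧ v ∈ bag b'}).Connected
  /-- every non-root bag has a hook in its parent bag: adjacent to all of the bag
  and to no vertex in a strict descendant bag -/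
  hook : ∀ b : ι, b ≠ root → ∃ h ∈ bag (parent b),
    (∀ v ∈ bag b, G.Adj h v) ∧
    (∀ b' : ι, (∃ n : ℕ, parent^[n] b' = b) → b' ≠ b → ∀ v ∈ bag b', ¬ G.Adj h v)

namespace GyarfasDecomp

variable {V : Type*} {G : SimpleGraph V} (Y : GyarfasDecomp G)

theorem level_iterate_parent (b : Y.ι) (n : ℕ) :
    Y.level (Y.parent^[n] b) = Y.level b - n := by
  induction n with
  | zero => rfl
  | succ n ih =>
    rw [Function.iterate_succ_apply']
    by_cases h : Y.parent^[n] b = Y.root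
    · rw [h, Y.parent_root]
      rw [h, Y.level_root] at ih
      rw [Y.level_root]
      omega
    · have := Y.level_parent _ h
      omega

theorem ne_root_of_level_ne_zero {b : Y.ι} (h : Y.level b ≠ 0) : b ≠ Y.root := by
  rintro rfl
  exact h Y.level_root

/-- The hooks along a branch of length at least `t - 1` form an induced path. -/
theorem containsInduced_pathG_of_le_level {t : ℕ} {b : Y.ι} (hb : t ≤ Y.level b + 1) :
    ContainsInduced (pathG t) G := by
  set L := Y.level b with hL
  let a : ℕ → Y.ι := fun i => Y.parent^[L - i] b
  have ha_level : ∀ i ≤ L, Y.level (a i) = i := fun i hi => by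
    simp only [a, level_iterate_parent]
    omega
  have ha_anc : ∀ i j, i ≤ j → j ≤ L → Y.parent^[j - i] (a j) = a i := fun i j hij hj => by
    simp only [a, ← Function.iterate_add_apply]
    congr 2
    omega
  have ha_parent : ∀ i < L, Y.parent (a (i + 1)) = a i := fun i hi => by
    simpa using ha_anc i (i + 1) (by omega) hi
  have key : ∀ i : ℕ, ∃ x, i ≤ L → x ∈ Y.bag (a i) ∧ (i < L →
      (∀ v ∈ Y.bag (a (i + 1)), G.Adj x v) ∧
      (∀ b' : Y.ι, (∃ n : ℕ, Y.parent^[n] b' = a (i + 1)) → b' ≠ a (i + 1) →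
        ∀ v ∈ Y.bag b', ¬ G.Adj x v)) := by
    intro i
    rcases lt_or_ge i L with hi | hi
    · obtain ⟨h, hh, hadj⟩ := Y.hook (a (i + 1))
        (Y.ne_root_of_level_ne_zero (by rw [ha_level _ hi]; omega))
      rw [ha_parent i hi] at hh
      exact ⟨h, fun _ => ⟨hh, fun _ => hadj⟩⟩
    · obtain ⟨x, hx⟩ := Y.bag_nonempty (a i)
      exact ⟨x, fun _ => ⟨hx, fun h => absurd h (by omega)⟩⟩
  choose f hf using key
  have hadj : ∀ i j, i < j → j ≤ L → (G.Adj (f i) (f j) ↔ i + 1 = j) := by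
    intro i j hij hj
    have h := (hf i (by omega)).2 (by omega)
    constructor
    · intro hadj
      by_contra hne
      refine h.2 (a j) ⟨_, ha_anc (i + 1) j hij hj⟩ (fun heq => hne ?_) _ (hf j hj).1 hadj
      rw [← ha_level j hj, heq, ha_level _ (by omega)]
    · rintro rfl
      exact h.1 _ (hf _ hj).1
  refine ⟨fun i => f i, fun i j hij => ?_, fun i j hij => ?_⟩
  · by_contra hne
    have hi : (i : ℕ) ≤ L := by omega
    have hj : (j : ℕ) ≤ L := by omega
    have hne' : a i ≠ a j := fun h => hne <| Fin.ext <| by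
      rw [← ha_level i hi, h, ha_level j hj]
    refine Set.disjoint_left.mp (Y.bag_disjoint _ _ hne') (hf i hi).1 ?_
    have := (hf j hj).1
    rwa [← show f i = f j from hij] at this
  · have hij' : (i : ℕ) ≠ j := fun h => hij (Fin.ext h)
    simp only [pathG, SimpleGraph.fromRel_adj]
    rcases lt_or_gt_of_ne hij' with h | h
    · rw [hadj i j h (by omega)]
      constructor
      · exact fun h => ⟨hij, .inl h⟩
      · rintro ⟨_, _ | _⟩ <;> omega
    · rw [G.adj_comm, hadj j i h (by omega)]
      constructor
      · exact fun h => ⟨hij, .inr h⟩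
      · rintro ⟨_, _ | _⟩ <;> omega

end GyarfasDecomp

namespace SimpleGraph

variable {V : Type*} (G : SimpleGraph V)

/-- `C` is the vertex set of a connected component of the subgraph of `G` induced by `S`. -/
structure IsComponentIn (S C : Set V) : Prop where
  subset : C ⊆ S
  connected : (G.induce C).Connected
  closed : ∀ u ∈ C, ∀ v ∈ S, G.Adj u v → v ∈ C

variable {G}

theorem exists_adj_of_induce_connected {C D : Set V} (hC : (G.induce C).Connected)
    {u v : V} (hu : u ∈ C) (hv : v ∈ C) (huD : u ∈ D) (hvD : v ∉ D) :
    ∃ x ∈ C, ∃ y ∈ C, x ∈ D ∧ y ∉ D ∧ G.Adj x y := by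
  obtain ⟨p⟩ := hC.preconnected ⟨u, hu⟩ ⟨v, hv⟩
  obtain ⟨d, -, h₁, h₂⟩ := p.exists_boundary_dart {x | (x : V) ∈ D} huD hvD
  exact ⟨d.fst, d.fst.2, d.snd, d.snd.2, h₁, h₂, d.adj⟩

theorem IsComponentIn.subset_of_mem {S C C' : Set V} (h : G.IsComponentIn S C)
    (h' : G.IsComponentIn S C') {u : V} (hu : u ∈ C) (hu' : u ∈ C') : C ⊆ C' := by
  intro v hv
  by_contra hv'
  obtain ⟨x, -, y, hy, hx', hy', hxy⟩ := exists_adj_of_induce_connected h.connected hu hv hu' hv'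
  exact hy' (h'.closed x hx' y (h.subset hy) hxy)

theorem IsComponentIn.eq_of_mem {S C C' : Set V} (h : G.IsComponentIn S C)
    (h' : G.IsComponentIn S C') {u : V} (hu : u ∈ C) (hu' : u ∈ C') : C = C' :=
  (h.subset_of_mem h' hu hu').antisymm (h'.subset_of_mem h hu' hu)

theorem exists_isComponentIn [Finite V] {S : Set V} {v : V} (hv : v ∈ S) :
    ∃ C, G.IsComponentIn S C ∧ v ∈ C := by
  have hsing : ({v} : Set V) ⊆ S ∧ (G.induce ({v} : Set V)).Connected :=
    ⟨by simpa using hv, by simp⟩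
  obtain ⟨C, hvC, hC⟩ := Finite.exists_le_maximal
    (p := fun C : Set V => C ⊆ S ∧ (G.induce C).Connected) hsing
  refine ⟨C, ⟨hC.prop.1, hC.prop.2, fun u hu w hw huw => ?_⟩, hvC rfl⟩
  refine hC.le_of_ge (y := C ∪ {u, w}) ⟨?_, ?_⟩ Set.subset_union_left (by simp)
  · rintro x (hx | rfl | rfl)
    exacts [hC.prop.1 hx, hC.prop.1 hu, hw]
  · exact induce_union_connected hC.prop.2.preconnected
      (induce_pair_connected_of_adj huw).preconnected ⟨u, hu, by simp⟩

end SimpleGraph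

namespace Gyarfas

variable {V : Type*} (G : SimpleGraph V) (r : V)

open Classical in
/-- A vertex of `B` with a neighbour in `C`, if there is one. -/
noncomputable def hook (B C : Set V) : V :=
  if h : ∃ x ∈ B, ∃ y ∈ C, G.Adj x y then h.choose else r

/-- Nodes of the decomposition are represented by the list of the cones (unions of the bags of all
descendants) on the branch from the node up to the root, the cone of the root being omitted. -/
def cone : List (Set V) → Set V
  | [] => Set.univ
  | C :: _ => C

/-- The bag of a node. -/
noncomputable def bag : List (Set V) → Set V
  | [] => {r}
  | C :: l => {v ∈ C | G.Adj (hook G r (bag l) C) v}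

/-- The cone of a child is a component of the cone of its parent with the parent's bag removed. -/
def Valid : List (Set V) → Prop
  | [] => True
  | C :: l => Valid l ∧ G.IsComponentIn (cone l \ bag G r l) C

variable {G r}

theorem hook_spec {B C : Set V} (h : ∃ x ∈ B, ∃ y ∈ C, G.Adj x y) :
    hook G r B C ∈ B ∧ ∃ y ∈ C, G.Adj (hook G r B C) y := by
  rw [hook, dif_pos h]
  exact h.choose_spec

theorem bag_subset_cone : ∀ l, bag G r l ⊆ cone l
  | [] => Set.subset_univ _
  | _ :: _ => fun _ hv => hv.1

theorem Valid.connected (hG : G.Connected) : ∀ {l}, Valid G r l → (G.induce (cone l)).Connected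
  | [], _ => (SimpleGraph.induceUnivIso G).connected_iff.mpr hG
  | _ :: _, h => h.2.connected

theorem Valid.exists_adj (hG : G.Connected) {l : List (Set V)} {C : Set V}
    (h : Valid G r (C :: l)) (hne : (bag G r l).Nonempty) :
    ∃ x ∈ bag G r l, ∃ y ∈ C, G.Adj x y := by
  obtain ⟨b, hb⟩ := hne
  obtain ⟨⟨c, hc⟩⟩ := h.2.connected.nonempty
  obtain ⟨x, -, y, hy, hxC, hyC, hxy⟩ := SimpleGraph.exists_adj_of_induce_connected
    (h.1.connected hG) (h.2.subset hc).1 (bag_subset_cone _ hb) hc (fun hbC => (h.2.subset hbC).2 hb)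
  refine ⟨y, ?_, x, hxC, hxy.symm⟩
  by_contra hyB
  exact hyC (h.2.closed x hxC y ⟨hy, hyB⟩ hxy)

theorem Valid.bag_nonempty (hG : G.Connected) : ∀ {l}, Valid G r l → (bag G r l).Nonempty
  | [], _ => Set.singleton_nonempty r
  | _ :: _, h =>
    have ⟨_, y, hy, hadj⟩ := hook_spec (r := r) (h.exists_adj hG (h.1.bag_nonempty hG))
    ⟨y, hy, hadj⟩

theorem Valid.of_suffix {l l' : List (Set V)} (h : Valid G r l') (hs : l <:+ l') :
    Valid G r l := by
  induction l' with
  | nil => rwa [List.suffix_nil.mp hs]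
  | cons C l' ih =>
    rcases List.suffix_cons_iff.mp hs with rfl | hs
    exacts [h, ih h.1 hs]

theorem Valid.cone_subset {l l' : List (Set V)} (h : Valid G r l') (hs : l <:+ l') :
    cone l' ⊆ cone l := by
  induction l' with
  | nil => rw [List.suffix_nil.mp hs]
  | cons C l' ih =>
    rcases List.suffix_cons_iff.mp hs with rfl | hs
    exacts [subset_rfl, fun v hv => ih h.1 hs (h.2.subset hv).1]

theorem exists_cons_suffix {α : Type*} {l l' : List α} (hs : l <:+ l') (hne : l ≠ l') :
    ∃ a, (a :: l) <:+ l' := by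
  induction l' with
  | nil => exact absurd (List.suffix_nil.mp hs) hne
  | cons a l' ih =>
    rcases List.suffix_cons_iff.mp hs with rfl | hs
    · exact absurd rfl hne
    · by_cases h : l = l'
      · exact ⟨a, h ▸ List.suffix_rfl⟩
      · obtain ⟨b, hb⟩ := ih hs h
        exact ⟨b, hb.trans (List.suffix_cons _ _)⟩

theorem Valid.cone_subset_diff {l l' : List (Set V)} (h : Valid G r l') (hs : l <:+ l')
    (hne : l ≠ l') : cone l' ⊆ cone l \ bag G r l := by
  obtain ⟨C, hC⟩ := exists_cons_suffix hs hne
  exact (h.cone_subset hC).trans (h.of_suffix hC).2.subset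

/-- Incomparable nodes have disjoint cones with no edges between them. -/
theorem Valid.suffix_or_suffix {l l' : List (Set V)} (h : Valid G r l) (h' : Valid G r l')
    {u u' : V} (hu : u ∈ cone l) (hu' : u' ∈ cone l') (huu' : u = u' ∨ G.Adj u u') :
    l <:+ l' ∨ l' <:+ l := by
  induction l with
  | nil => exact .inl List.nil_suffix
  | cons C l ih =>
    rcases ih h.1 (h.2.subset hu).1 with hs | hs
    · by_cases hl : l = l'
      · exact .inr (hl ▸ List.suffix_cons _ _)
      · obtain ⟨C', hC'⟩ := exists_cons_suffix hs hl
        have hcomp := (h'.of_suffix hC').2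
        have hu'C' : u' ∈ C' := h'.cone_subset hC' hu'
        have hu'C : u' ∈ C := by
          rcases huu' with rfl | hadj
          exacts [hu, h.2.closed u hu u' (hcomp.subset hu'C') hadj]
        rw [h.2.eq_of_mem hcomp hu'C hu'C']
        exact .inl hC'
    · exact .inr (hs.trans (List.suffix_cons _ _))

theorem Valid.disjoint_bag {l l' : List (Set V)} (h : Valid G r l) (h' : Valid G r l')
    (hne : l ≠ l') : Disjoint (bag G r l) (bag G r l') := by
  refine Set.disjoint_left.mpr fun u hu hu' => ?_
  rcases h.suffix_or_suffix h' (bag_subset_cone _ hu) (bag_subset_cone _ hu') (.inl rfl) with hs | hs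
  · exact (h'.cone_subset_diff hs hne (bag_subset_cone _ hu')).2 hu
  · exact (h.cone_subset_diff hs hne.symm (bag_subset_cone _ hu)).2 hu'

theorem Valid.exists_mem_bag [Finite V] (hG : G.Connected) {l : List (Set V)} (h : Valid G r l)
    {v : V} (hv : v ∈ cone l) : ∃ l', Valid G r l' ∧ l <:+ l' ∧ v ∈ bag G r l' := by
  induction hn : (cone l).ncard using Nat.strong_induction_on generalizing l with
  | _ n ih =>
    by_cases hvB : v ∈ bag G r l
    · exact ⟨l, h, List.suffix_rfl, hvB⟩
    obtain ⟨C, hC, hvC⟩ := SimpleGraph.exists_isComponentIn (G := G)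
      (show v ∈ cone l \ bag G r l from ⟨hv, hvB⟩)
    have hlt : C.ncard < n := by
      obtain ⟨b, hb⟩ := h.bag_nonempty hG
      rw [← hn]
      refine Set.ncard_lt_ncard ⟨fun x hx => (hC.subset hx).1, fun hsub => ?_⟩
      exact (hC.subset (hsub (bag_subset_cone _ hb))).2 hb
    obtain ⟨l', hl', hs, hvl'⟩ := ih _ hlt (l := C :: l) ⟨h, hC⟩ hvC rfl
    exact ⟨l', hl', (List.suffix_cons _ _).trans hs, hvl'⟩

/-- The parent of a node. -/
def parent (b : {l // Valid G r l}) : {l // Valid G r l} :=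
  ⟨b.1.tail, b.2.of_suffix (List.tail_suffix _)⟩

theorem coe_iterate_parent (b : {l // Valid G r l}) (n : ℕ) :
    (parent^[n] b).1 = b.1.drop n := by
  induction n with
  | zero => rfl
  | succ n ih =>
    rw [Function.iterate_succ_apply', ← List.tail_drop, ← ih]
    rfl

theorem exists_iterate_parent_eq_iff {b b' : {l // Valid G r l}} :
    (∃ n : ℕ, parent^[n] b' = b) ↔ b.1 <:+ b'.1 := by
  constructor
  · rintro ⟨n, rfl⟩
    rw [coe_iterate_parent]
    exact List.drop_suffix _ _
  · intro h
    refine ⟨b'.1.length - b.1.length, Subtype.ext ?_⟩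
    rw [coe_iterate_parent]
    exact (List.suffix_iff_eq_drop.mp h).symm

theorem setOf_mem_bag_descendant [Finite V] (hG : G.Connected) (b : {l // Valid G r l}) :
    {v : V | ∃ b' : {l // Valid G r l}, (∃ n : ℕ, parent^[n] b' = b) ∧ v ∈ bag G r b'.1} =
      cone b.1 := by
  ext v
  simp only [exists_iterate_parent_eq_iff, Set.mem_ofPred_eq]
  constructor
  · rintro ⟨b', hs, hv⟩
    exact b'.2.cone_subset hs (bag_subset_cone _ hv)
  · intro hv
    obtain ⟨l', hl', hs, hvl'⟩ := b.2.exists_mem_bag hG hv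
    exact ⟨⟨l', hl'⟩, hs, hvl'⟩

theorem finite_valid [Finite V] (hG : G.Connected) : Finite {l // Valid G r l} := by
  refine Finite.of_injective (fun b => bag G r b.1) fun b b' h => ?_
  by_contra hne
  have hdisj := b.2.disjoint_bag b'.2 (fun h => hne (Subtype.ext h))
  rw [show bag G r b.1 = bag G r b'.1 from h, disjoint_self] at hdisj
  exact (b'.2.bag_nonempty hG).ne_empty hdisj

/-- The Gyárfás decomposition of a finite connected graph with given initial vertex. -/
noncomputable def decomp {V : Type} [Finite V] {G : SimpleGraph V} (hG : G.Connected) (r : V) :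
    GyarfasDecomp G where
  ι := {l // Valid G r l}
  fin := have := finite_valid (r := r) hG; Fintype.ofFinite _
  bag b := bag G r b.1
  root := ⟨[], trivial⟩
  parent := parent
  level b := b.1.length
  init := r
  parent_root := rfl
  reach b := exists_iterate_parent_eq_iff.mpr List.nil_suffix
  level_root := rfl
  level_parent := by
    rintro ⟨_ | ⟨C, l⟩, h⟩ hne
    exacts [absurd rfl hne, rfl]
  bag_nonempty b := b.2.bag_nonempty hG
  bag_disjoint b b' hne := b.2.disjoint_bag b'.2 fun h => hne (Subtype.ext h)
  bag_cover v := by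
    obtain ⟨l, hl, -, hv⟩ :=
      Valid.exists_mem_bag (r := r) hG (l := []) trivial (Set.mem_univ v)
    exact ⟨⟨l, hl⟩, hv⟩
  root_bag := rfl
  adj_anc u u' b b' hu hu' hadj := by
    simp only [exists_iterate_parent_eq_iff]
    exact b.2.suffix_or_suffix b'.2 (bag_subset_cone _ hu) (bag_subset_cone _ hu') (.inr hadj)
  conn b := by
    rw [setOf_mem_bag_descendant hG b]
    exact b.2.connected hG
  hook := by
    rintro ⟨_ | ⟨C, l⟩, h⟩ hne
    · exact absurd rfl hne
    refine ⟨hook G r (bag G r l) C, (hook_spec (h.exists_adj hG (h.1.bag_nonempty hG))).1,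
      fun v hv => hv.2, fun b' hb' hne' v hv hadj => ?_⟩
    rw [exists_iterate_parent_eq_iff] at hb'
    have := b'.2.cone_subset_diff hb' (fun h => hne' (Subtype.ext h.symm)) (bag_subset_cone _ hv)
    exact this.2 ⟨this.1, hadj⟩

end Gyarfas

theorem stmt10 (t : ℕ) (ht : 2 ≤ t) (V : Type) [Fintype V] (G : SimpleGraph V)
    (hconn : G.Connected) (hPt : ¬ ContainsInduced (pathG t) G) (r : V) :
    ∃ Y : GyarfasDecomp G, Y.init = r ∧ ∀ b : Y.ι, Y.level b ≤ t - 2 := by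
  refine ⟨Gyarfas.decomp hconn r, rfl, fun b => ?_⟩
  by_contra hb
  exact hPt (GyarfasDecomp.containsInduced_pathG_of_le_level _ (b := b) (by omega))
end

section
/- Let G be a finite connected bipartite simple graph with bipartition {L, R} (L and R are disjoint independent sets covering V(G)), and let Y be a Gyárfás decomposition of G whose initial vertex lies in L. Then every bag of Y is an independent set in G; moreover, every bag of even level is contained in L and every bag of odd level is contained in R. -/
/-- In a bipartite graph, the bags of a Gyárfás decomposition whose initial vertex lies in `L`
alternate between `L` and `R` along the levels. -/
theorem GyarfasDecomp.bag_subset_of_level {V : Type*} {G : SimpleGraph V} {L R : Set V}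
    (hcover : L ∪ R = Set.univ)
    (hLindep : ∀ u ∈ L, ∀ v ∈ L, ¬ G.Adj u v)
    (hRindep : ∀ u ∈ R, ∀ v ∈ R, ¬ G.Adj u v)
    (Y : GyarfasDecomp G) (hinit : Y.init ∈ L) (n : ℕ) :
    ∀ b : Y.ι, Y.level b = n →
      (n % 2 = 0 → Y.bag b ⊆ L) ∧ (n % 2 = 1 → Y.bag b ⊆ R) := by
  induction n with
  | zero =>
    intro b hb
    refine ⟨fun _ v hv => ?_, fun h => by omega⟩
    by_cases hr : b = Y.root
    · rw [hr, Y.root_bag, Set.mem_singleton_iff] at hv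
      exact hv ▸ hinit
    · have := Y.level_parent b hr
      omega
  | succ n ih =>
    intro b hb
    have hr : b ≠ Y.root := by
      rintro rfl
      have := Y.level_root
      omega
    have hp := Y.level_parent b hr
    obtain ⟨h, hh, hadj, -⟩ := Y.hook b hr
    obtain ⟨h0, h1⟩ := ih (Y.parent b) (by omega)
    refine ⟨fun hn v hv => ?_, fun hn v hv => ?_⟩
    · have hv' : v ∈ L ∪ R := hcover ▸ Set.mem_univ v
      exact hv'.resolve_right fun hvR => hRindep h (h1 (by omega) hh) v hvR (hadj v hv)
    · have hv' : v ∈ L ∪ R := hcover ▸ Set.mem_univ v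
      exact hv'.resolve_left fun hvL => hLindep h (h0 (by omega) hh) v hvL (hadj v hv)

theorem stmt11 (V : Type) [Fintype V] (G : SimpleGraph V) (hconn : G.Connected)
    (L R : Set V) (hdisj : Disjoint L R) (hcover : L ∪ R = Set.univ)
    (hLindep : ∀ u ∈ L, ∀ v ∈ L, ¬ G.Adj u v)
    (hRindep : ∀ u ∈ R, ∀ v ∈ R, ¬ G.Adj u v)
    (Y : GyarfasDecomp G) (hinit : Y.init ∈ L) :
    (∀ b : Y.ι, ∀ u ∈ Y.bag b, ∀ v ∈ Y.bag b, ¬ G.Adj u v) ∧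
    (∀ b : Y.ι, Y.level b % 2 = 0 → Y.bag b ⊆ L) ∧
    (∀ b : Y.ι, Y.level b % 2 = 1 → Y.bag b ⊆ R) := by
  have key := fun b => Y.bag_subset_of_level hcover hLindep hRindep hinit (Y.level b) b rfl
  refine ⟨fun b u hu v hv => ?_, fun b => (key b).1, fun b => (key b).2⟩
  rcases Nat.mod_two_eq_zero_or_one (Y.level b) with h | h
  · exact hLindep u ((key b).1 h hu) v ((key b).1 h hv)
  · exact hRindep u ((key b).2 h hu) v ((key b).2 h hv)
end

section
/- Let G be a finite simple graph, let B be a set of vertices of G, and let u and v be two distinct vertices not in B such that u is adjacent to every vertex of B and v is adjacent to no vertex of B. If G contains a strong configuration of order k all of whose vertices lie in B, then G contains a strong configuration of order k + 1. -/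
/-- `G` contains a strong configuration of order `k`: pairwise distinct vertices
`a_1,…,a_k` (a clique) and `b_1,…,b_k` (an independent set) such that for `i < j`,
`a_i` is adjacent to `b_j` and `b_i` is not adjacent to `a_j`. -/
def StrongConfig {V : Type*} (G : SimpleGraph V) (k : ℕ) : Prop :=
  ∃ a b : Fin k → V,
    Function.Injective a ∧ Function.Injective b ∧
    (∀ i j : Fin k, a i ≠ b j) ∧
    (∀ i j : Fin k, i ≠ j → G.Adj (a i) (a j)) ∧
    (∀ i j : Fin k, ¬ G.Adj (b i) (b j)) ∧
    (∀ i j : Fin k, i < j → G.Adj (a i) (b j) ∧ ¬ G.Adj (b i) (a j))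

theorem stmt12 (V : Type) [Fintype V] (G : SimpleGraph V) (B : Set V)
    (u v : V) (hu : u ∉ B) (hv : v ∉ B) (huv : u ≠ v)
    (hu_adj : ∀ w ∈ B, G.Adj u w) (hv_nadj : ∀ w ∈ B, ¬ G.Adj v w)
    (k : ℕ)
    (h : ∃ a b : Fin k → V, (∀ i, a i ∈ B) ∧ (∀ i, b i ∈ B) ∧
      Function.Injective a ∧ Function.Injective b ∧
      (∀ i j : Fin k, a i ≠ b j) ∧
      (∀ i j : Fin k, i ≠ j → G.Adj (a i) (a j)) ∧
      (∀ i j : Fin k, ¬ G.Adj (b i) (b j)) ∧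
      (∀ i j : Fin k, i < j → G.Adj (a i) (b j) ∧ ¬ G.Adj (b i) (a j))) :
    StrongConfig G (k + 1) := by
  obtain ⟨a, b, haB, hbB, ha, hb, hab, hclique, hindep, hlt⟩ := h
  refine ⟨Fin.cons u a, Fin.cons v b, Fin.cons_injective_iff.2 ⟨?_, ha⟩,
    Fin.cons_injective_iff.2 ⟨?_, hb⟩, ?_, ?_, ?_, ?_⟩
  · rintro ⟨i, rfl⟩
    exact hu (haB i)
  · rintro ⟨i, rfl⟩
    exact hv (hbB i)
  · refine Fin.cases (Fin.cases huv fun j e => hu ?_) fun i => Fin.cases (fun e => hv ?_) ?_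
    · simp only [Fin.cons_zero, Fin.cons_succ] at e
      exact e ▸ hbB j
    · simp only [Fin.cons_zero, Fin.cons_succ] at e
      exact e ▸ haB i
    · simpa using hab i
  · refine Fin.cases (Fin.cases (by simp) fun j _ => ?_) fun i => Fin.cases (fun _ => ?_)
      fun j hij => ?_
    · simpa using hu_adj _ (haB j)
    · simpa using (hu_adj _ (haB i)).symm
    · simpa using hclique i j (by simpa using hij)
  · refine Fin.cases (Fin.cases (by simp) fun j => ?_) fun i => Fin.cases ?_ fun j => ?_
    · simpa using hv_nadj _ (hbB j)
    · simpa [G.adj_comm] using hv_nadj _ (hbB i)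
    · simpa using hindep i j
  · refine Fin.cases (Fin.cases (by simp) fun j _ => ?_) fun i => Fin.cases (by simp)
      fun j hij => ?_
    · simpa using ⟨hu_adj _ (hbB j), hv_nadj _ (haB j)⟩
    · simpa using hlt i j (by simpa using hij)
end

section
/- Let A and B be finite sets and let R ⊆ A × B be a relation such that the simple graph on the disjoint union A ⊔ B, in which a ∈ A and b ∈ B are adjacent iff R(a,b) (and there are no other edges), is connected. If R contains no bipartite configuration of order 2, then R(a,b) holds for all a ∈ A and b ∈ B, i.e., the bipartite graph is complete bipartite. -/
/-- The bipartite graph given by `R : A → B → Prop` contains a bipartite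
configuration of order `k`. -/
def BipConfig {A B : Type*} (R : A → B → Prop) (k : ℕ) : Prop :=
  ∃ (a : Fin k → A) (b : Fin k → B),
    Function.Injective a ∧ Function.Injective b ∧
    ∀ i j : Fin k, i < j → R (a i) (b j) ∧ ¬ R (a j) (b i)

/-- The simple graph on the disjoint union `A ⊕ B` in which `a ∈ A` and `b ∈ B`
are adjacent iff `R a b`, and there are no other edges. -/
def bipGraph {A B : Type*} (R : A → B → Prop) : SimpleGraph (A ⊕ B) :=
  SimpleGraph.fromRel (fun x y =>
    match x, y with
    | Sum.inl a, Sum.inr b => R a b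
    | _, _ => False)

theorem SimpleGraph.Reachable.of_adj_closed {V : Type*} {G : SimpleGraph V} {P : V → Prop}
    (hP : ∀ x y, G.Adj x y → P x → P y) {x y : V} (hxy : G.Reachable x y) (hx : P x) : P y := by
  obtain ⟨w⟩ := hxy
  induction w with
  | nil => exact hx
  | cons hadj _ ih => exact ih (hP _ _ hadj hx)

theorem eq_or_eq_of_not_bipConfig_two {A B : Type*} {R : A → B → Prop} (h : ¬ BipConfig R 2)
    {a a' : A} {b b' : B} (hR : R a b') (hnR : ¬ R a' b) : a = a' ∨ b' = b := by
  by_contra! hne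
  refine h ⟨![a, a'], ![b, b'], ?_, ?_, ?_⟩
  · intro i j hij
    fin_cases i <;> fin_cases j <;> simp_all
  · intro i j hij
    fin_cases i <;> fin_cases j <;> simp_all
  · intro i j hij
    fin_cases i <;> fin_cases j <;> simp_all

theorem stmt14 (A B : Type) [Fintype A] [Fintype B] (R : A → B → Prop)
    (hconn : (bipGraph R).Connected) (h : ¬ BipConfig R 2) :
    ∀ (a : A) (b : B), R a b := by
  intro a b
  by_contra hab
  have hclosed : ∀ x y, (bipGraph R).Adj x y →
      Sum.elim (fun a' => a' = a) (fun b' => b' ≠ b) x →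
      Sum.elim (fun a' => a' = a) (fun b' => b' ≠ b) y := by
    rintro (a₁ | b₁) (a₂ | b₂) hadj hx <;>
      simp only [bipGraph, SimpleGraph.fromRel_adj, Sum.elim_inl, Sum.elim_inr, or_false,
        false_or, and_false] at hadj hx ⊢
    · rintro rfl
      subst hx
      exact hab hadj.2
    · exact (eq_or_eq_of_not_bipConfig_two h hadj.2 hab).resolve_right hx
  exact (hconn.preconnected (Sum.inl a) (Sum.inr b)).of_adj_closed hclosed rfl rfl
end

section
/- Let A and B be sets, let R ⊆ A × B be a relation, and let k ≥ 1 be an integer. If R contains a bipartite configuration of order 2k+1, then there exist pairwise distinct a_1,…,a_k ∈ A and pairwise distinct b_1,…,b_k ∈ B such that for all 1 ≤ i, j ≤ k, R(a_i,b_j) holds if and only if i ≤ j. (That is, the bipartite graph contains an induced half-graph H_k.) -/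
theorem stmt15 (A B : Type) (R : A → B → Prop) (k : ℕ) (hk : 1 ≤ k)
    (h : BipConfig R (2 * k + 1)) :
    ∃ (a : Fin k → A) (b : Fin k → B),
      Function.Injective a ∧ Function.Injective b ∧
      ∀ i j : Fin k, R (a i) (b j) ↔ i ≤ j := by
  obtain ⟨a, b, ha, hb, hR⟩ := h
  -- Even-indexed left vertices against odd-indexed right vertices avoid the diagonal.
  refine ⟨fun i => a ⟨2 * i, by omega⟩, fun i => b ⟨2 * i + 1, by omega⟩, ?_, ?_, ?_⟩
  · intro i j hij
    have := Fin.mk.inj (ha hij)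
    omega
  · intro i j hij
    have := Fin.mk.inj (hb hij)
    omega
  · intro i j
    rw [Fin.le_def]
    constructor
    · intro hij
      by_contra hlt
      exact (hR ⟨2 * j + 1, by omega⟩ ⟨2 * i, by omega⟩ (Fin.mk_lt_mk.2 (by omega))).2 hij
    · intro hle
      exact (hR _ _ (Fin.mk_lt_mk.2 (by omega))).1
end

section
/- Let G be a finite simple graph containing no strong configuration of order 2, and let u be a vertex of G. Let X be the set of neighbors of u and let Y = V(G) \ (X ∪ {u}) be the set of non-neighbors of u other than u. Then every vertex of Y has at most one neighbor in Y (the subgraph induced by Y has maximum degree at most 1), and every vertex of X is non-adjacent to at most one other vertex of X (the complement of the subgraph induced by X has maximum degree at most 1). -/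
/-- Two edges `p q`, `p s` and two non-edges `r s`, `r q` on distinct vertices form a strong
configuration of order `2`. -/
theorem strongConfig_two_of_adj {V : Type*} {G : SimpleGraph V} {p q r s : V}
    (hpr : p ≠ r) (hqr : q ≠ r) (hqs : q ≠ s) (hrs : r ≠ s)
    (hpq : G.Adj p q) (hps : G.Adj p s) (hnrs : ¬ G.Adj r s) (hnrq : ¬ G.Adj r q) :
    StrongConfig G 2 := by
  refine ⟨![p, q], ![r, s], ?_, ?_, ?_, ?_, ?_, ?_⟩
  · intro i j
    fin_cases i <;> fin_cases j <;> simp [hpq.ne, hpq.ne.symm]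
  · intro i j
    fin_cases i <;> fin_cases j <;> simp [hrs, hrs.symm]
  · simp [Fin.forall_fin_two, hpr, hps.ne, hqr, hqs]
  · simp [Fin.forall_fin_two, hpq, hpq.symm]
  · simp [Fin.forall_fin_two, hnrs, G.adj_comm s r]
  · simp [Fin.forall_fin_two, hps, hnrq]

theorem stmt17 (V : Type) [Fintype V] (G : SimpleGraph V)
    (h : ¬ StrongConfig G 2) (u : V)
    (X Y : Set V) (hX : X = {w | G.Adj u w}) (hY : Y = {w | ¬ G.Adj u w ∧ w ≠ u}) :
    (∀ y ∈ Y, ∀ y₁ ∈ Y, ∀ y₂ ∈ Y, G.Adj y y₁ → G.Adj y y₂ → y₁ = y₂) ∧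
    (∀ x ∈ X, ∀ x₁ ∈ X, ∀ x₂ ∈ X, x₁ ≠ x → x₂ ≠ x →
      ¬ G.Adj x x₁ → ¬ G.Adj x x₂ → x₁ = x₂) := by
  subst hX hY
  refine ⟨fun y hy y₁ hy₁ y₂ hy₂ h₁ h₂ => ?_, fun x hx x₁ hx₁ x₂ hx₂ hne₁ hne₂ h₁ h₂ => ?_⟩
  · by_contra hne
    exact h (strongConfig_two_of_adj hy.2 hy₁.2 hne hy₂.2.symm h₁ h₂ hy₂.1 hy₁.1)
  · by_contra hne
    exact h (strongConfig_two_of_adj (SimpleGraph.Adj.ne hx) hne₁ hne hne₂.symm hx₁ hx₂ h₂ h₁)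
end
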